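/- arXiv:1604.01160 — 8 statements merged into one kernel-verified Lean document; each statement's English description precedes it below -/
import Mathlib

section
/- Let m, n ≥ 1, let Y be an m×n complex matrix, let s be a nonzero vector in ℂ^n, and set N = m·n. Assume ‖Y‖_F² > ‖Y s̄‖₂²/‖s‖₂² (where s̄ denotes the entrywise complex conjugate of s, so Y s̄ ∈ ℂ^m). Then the generalized likelihood ratio sup_{h ∈ ℂ^m, σ₁² > 0} (π σ₁²)^{−N} exp(−‖Y − h sᵀ‖_F²/σ₁²) divided by sup_{σ₀² > 0} (π σ₀²)^{−N} exp(−‖Y‖_F²/σ₀²) equals ( ‖Y‖_F² / (‖Y‖_F² − ‖Y s̄‖₂²/‖s‖₂²) )^N. -/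
open scoped BigOperators

open Finset in
/-- Completing the square in the residual of a complex vector against the multiples of `s`. -/
theorem sum_norm_sub_mul_sq {ι : Type*} [Fintype ι] (y s : ι → ℂ) (c : ℂ)
    (hS : ∑ k, ‖s k‖ ^ 2 ≠ 0) :
    ∑ j, ‖y j - c * s j‖ ^ 2
      = ∑ j, ‖y j‖ ^ 2 - ‖∑ k, y k * (starRingEnd ℂ) (s k)‖ ^ 2 / (∑ k, ‖s k‖ ^ 2)
        + (∑ k, ‖s k‖ ^ 2)
          * ‖c - (∑ k, y k * (starRingEnd ℂ) (s k)) / ((∑ k, ‖s k‖ ^ 2 : ℝ) : ℂ)‖ ^ 2 := by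
  have expand : ∑ j, ‖y j - c * s j‖ ^ 2 = ∑ j, ‖y j‖ ^ 2 + ‖c‖ ^ 2 * ∑ k, ‖s k‖ ^ 2
      - 2 * ((∑ k, y k * (starRingEnd ℂ) (s k)) * (starRingEnd ℂ) c).re := by
    rw [sum_mul, Complex.re_sum, mul_sum, mul_sum, ← sum_add_distrib, ← sum_sub_distrib]
    refine sum_congr rfl fun j _ => ?_
    simp only [Complex.sq_norm, Complex.normSq_sub, map_mul]
    rw [mul_assoc (y j), mul_comm ((starRingEnd ℂ) (s j))]
  rw [expand]
  generalize ∑ k, y k * (starRingEnd ℂ) (s k) = a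
  generalize ∑ k, ‖s k‖ ^ 2 = S at hS
  simp only [Complex.sq_norm, Complex.normSq_apply, Complex.sub_re, Complex.sub_im,
    Complex.div_ofReal_re, Complex.div_ofReal_im, Complex.mul_re, Complex.conj_re,
    Complex.conj_im]
  field_simp
  ring

/-- The Gaussian likelihood with residual energy `E` is maximised at the variance `E / N`. -/
theorem gaussian_likelihood_le {N : ℕ} (hN : N ≠ 0) {E σ : ℝ} (hE : 0 < E) (hσ : 0 < σ) :
    ((Real.pi * σ) ^ N)⁻¹ * Real.exp (-E / σ)
      ≤ ((Real.pi * (E / N)) ^ N)⁻¹ * Real.exp (-E / (E / N)) := by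
  have hN' : (0 : ℝ) < N := by positivity
  have hπ := Real.pi_pos
  set u : ℝ := E / N / σ with hu
  have hu0 : 0 < u := by positivity
  have hpow : u ^ N ≤ Real.exp (E / σ - N) := by
    have h : u ≤ Real.exp (u - 1) := by linarith [Real.add_one_le_exp (u - 1)]
    calc u ^ N ≤ Real.exp (u - 1) ^ N := by gcongr
      _ = Real.exp (E / σ - N) := by
        rw [← Real.exp_nat_mul, hu]
        congr 1
        field_simp
  have hmul : (Real.pi * (E / N)) ^ N = (Real.pi * σ) ^ N * u ^ N := by
    rw [← mul_pow, hu]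
    congr 1
    field_simp
  have hEN : -E / (E / N) = -(N : ℝ) := by field_simp
  rw [hmul, hEN, mul_inv, mul_assoc]
  gcongr
  rw [← div_eq_inv_mul, le_div_iff₀ (by positivity)]
  calc Real.exp (-E / σ) * u ^ N ≤ Real.exp (-E / σ) * Real.exp (E / σ - N) := by gcongr
    _ = Real.exp (-(N : ℝ)) := by
      rw [← Real.exp_add]
      congr 1
      ring

/-- The maximum of the Gaussian likelihood over the variance and a parameter `h` is governed by the
minimal residual energy. -/
theorem isGreatest_gaussian_likelihood {α : Type*} {N : ℕ} (hN : N ≠ 0) (f : α → ℝ) (a : α)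
    (ha : 0 < f a) (hmin : ∀ h, f a ≤ f h) :
    IsGreatest {x : ℝ | ∃ (h : α) (σ : ℝ), 0 < σ ∧
        x = ((Real.pi * σ) ^ N)⁻¹ * Real.exp (-(f h) / σ)}
      (((Real.pi * (f a / N)) ^ N)⁻¹ * Real.exp (-(f a) / (f a / N))) := by
  refine ⟨⟨a, f a / N, by positivity, rfl⟩, ?_⟩
  rintro _ ⟨h, σ, hσ, rfl⟩
  refine le_trans ?_ (gaussian_likelihood_le hN ha hσ)
  have := Real.pi_pos
  gcongr
  exact hmin h

/-- Proposition 1 (GLRT statistic): the generalised likelihood ratio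
`sup_{h,σ₁²>0} (πσ₁²)^{-N} exp(−‖Y − h sᵀ‖_F²/σ₁²) / sup_{σ₀²>0} (πσ₀²)^{-N} exp(−‖Y‖_F²/σ₀²)`
equals `(‖Y‖_F² / (‖Y‖_F² − ‖Y s̄‖₂²/‖s‖₂²))^N`. -/
theorem stmt_0 (m n N : ℕ) (hm : 1 ≤ m) (hn : 1 ≤ n) (hN : N = m * n)
    (Y : Matrix (Fin m) (Fin n) ℂ) (s : Fin n → ℂ) (hs : s ≠ 0)
    (hstrict : (∑ i, ‖∑ k, Y i k * (starRingEnd ℂ) (s k)‖ ^ 2) / (∑ k, ‖s k‖ ^ 2)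
      < ∑ i, ∑ j, ‖Y i j‖ ^ 2) :
    sSup {x : ℝ | ∃ (h : Fin m → ℂ) (σ : ℝ), 0 < σ ∧
        x = ((Real.pi * σ) ^ N)⁻¹ *
          Real.exp (-(∑ i, ∑ j, ‖Y i j - h i * s j‖ ^ 2) / σ)} /
    sSup {x : ℝ | ∃ σ : ℝ, 0 < σ ∧
        x = ((Real.pi * σ) ^ N)⁻¹ *
          Real.exp (-(∑ i, ∑ j, ‖Y i j‖ ^ 2) / σ)}
    = ((∑ i, ∑ j, ‖Y i j‖ ^ 2) /
        ((∑ i, ∑ j, ‖Y i j‖ ^ 2)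
          - (∑ i, ‖∑ k, Y i k * (starRingEnd ℂ) (s k)‖ ^ 2) / (∑ k, ‖s k‖ ^ 2))) ^ N := by
  have hN0 : N ≠ 0 := by
    rw [hN]
    positivity
  have hS : 0 < ∑ k, ‖s k‖ ^ 2 := by
    obtain ⟨k, hk⟩ := Function.ne_iff.mp hs
    exact Finset.sum_pos' (fun _ _ => by positivity)
      ⟨k, Finset.mem_univ k, by have := norm_pos_iff.mpr hk; positivity⟩
  set S := ∑ k, ‖s k‖ ^ 2 with hSdef
  set A := ∑ i, ∑ j, ‖Y i j‖ ^ 2 with hA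
  set B := (∑ i, ‖∑ k, Y i k * (starRingEnd ℂ) (s k)‖ ^ 2) / S with hB
  have hA0 : 0 < A := lt_of_le_of_lt (by positivity) hstrict
  have hAB : 0 < A - B := sub_pos.mpr hstrict
  have key (h : Fin m → ℂ) : ∑ i, ∑ j, ‖Y i j - h i * s j‖ ^ 2 = A - B
      + ∑ i, S * ‖h i - (∑ k, Y i k * (starRingEnd ℂ) (s k)) / (S : ℂ)‖ ^ 2 := by
    rw [hA, hB, Finset.sum_div, ← Finset.sum_sub_distrib, ← Finset.sum_add_distrib]
    exact Finset.sum_congr rfl fun i _ => sum_norm_sub_mul_sq (Y i) s (h i) hS.ne'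
  let h₀ : Fin m → ℂ := fun i => (∑ k, Y i k * (starRingEnd ℂ) (s k)) / (S : ℂ)
  have hmin : ∑ i, ∑ j, ‖Y i j - h₀ i * s j‖ ^ 2 = A - B := by
    simp [key, h₀]
  have numerator := (isGreatest_gaussian_likelihood hN0
    (fun h : Fin m → ℂ => ∑ i, ∑ j, ‖Y i j - h i * s j‖ ^ 2) h₀ (by simpa only [hmin] using hAB)
    (fun h => by
      rw [hmin, key]
      exact le_add_of_nonneg_right (by positivity))).csSup_eq
  have denominator := (isGreatest_gaussian_likelihood hN0
    (fun _ : Unit => A) () hA0 fun _ => le_rfl).csSup_eq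
  simp only [exists_const] at denominator
  simp only [hmin] at numerator
  rw [numerator, denominator]
  have hN' : (N : ℝ) ≠ 0 := by exact_mod_cast hN0
  have exponent {E : ℝ} (hE : 0 < E) : -E / (E / N) = -(N : ℝ) := by field_simp
  rw [exponent hAB, exponent hA0, mul_div_mul_right _ _ (Real.exp_pos _).ne', inv_div_inv,
    ← div_pow]
  congr 1
  have := Real.pi_pos
  field_simp
end

section
/- Let u > 0, η > 0 and a > 0 be real numbers. Define f(t) = t·u − η·t/(1 − 2t) + a·log(1 − 2t) for t < 1/2, and set t* = 1/2 − (a + √(a² + η u))/(2u). Then t* < 1/2 and for every t < 1/2, f(t) ≤ f(t*); that is, f attains its supremum over (−∞, 1/2) at t*. -/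
/-- A positive root `y` of `u y² = 2 a y + η` maximizes the concave function
`x ↦ -u x / 2 - η / (2 x) + a log x` on the positive reals. -/
theorem log_sub_inv_sub_linear_le_of_root {u η a x y : ℝ} (hη : 0 ≤ η) (ha : 0 ≤ a)
    (hx : 0 < x) (hy : 0 < y) (hroot : u * y ^ 2 = 2 * a * y + η) :
    -(u * x / 2) - η / (2 * x) + a * Real.log x
      ≤ -(u * y / 2) - η / (2 * y) + a * Real.log y := by
  have hlog : Real.log x - Real.log y ≤ x / y - 1 := by
    rw [← Real.log_div hx.ne' hy.ne']
    exact Real.log_le_sub_one_of_pos (div_pos hx hy)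
  have hgap : u * x / 2 + η / (2 * x) - (u * y / 2 + η / (2 * y)) - a * (x / y - 1)
      = η * (x - y) ^ 2 / (2 * x * y ^ 2) := by
    obtain rfl : η = u * y ^ 2 - 2 * a * y := by linarith
    field_simp
    ring
  have hnonneg : 0 ≤ η * (x - y) ^ 2 / (2 * x * y ^ 2) := by positivity
  have := mul_le_mul_of_nonneg_left hlog ha
  linarith

/-- Legendre transform of the noncentral chi-square log-MGF:
`f(t) = t u − η t/(1 − 2t) + a log(1 − 2t)` on `(−∞, 1/2)` attains its supremum
at `t* = 1/2 − (a + √(a² + η u))/(2u)`. -/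
theorem stmt_7 (u η a : ℝ) (hu : 0 < u) (hη : 0 < η) (ha : 0 < a)
    (tstar : ℝ) (htstar : tstar = 1 / 2 - (a + Real.sqrt (a ^ 2 + η * u)) / (2 * u)) :
    tstar < 1 / 2 ∧
    ∀ t : ℝ, t < 1 / 2 →
      t * u - η * t / (1 - 2 * t) + a * Real.log (1 - 2 * t)
        ≤ tstar * u - η * tstar / (1 - 2 * tstar) + a * Real.log (1 - 2 * tstar) := by
  have hsq : Real.sqrt (a ^ 2 + η * u) ^ 2 = a ^ 2 + η * u := Real.sq_sqrt (by positivity)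
  have hy : 1 - 2 * tstar = (a + Real.sqrt (a ^ 2 + η * u)) / u := by
    rw [htstar]
    field_simp
    ring
  have hypos : 0 < 1 - 2 * tstar := by
    rw [hy]
    positivity
  have hroot : u * (1 - 2 * tstar) ^ 2 = 2 * a * (1 - 2 * tstar) + η := by
    rw [hy]
    generalize Real.sqrt (a ^ 2 + η * u) = s at hsq ⊢
    field_simp
    linarith
  have hsubst : ∀ t : ℝ, 0 < 1 - 2 * t →
      t * u - η * t / (1 - 2 * t)
        = (u + η) / 2 + (-(u * (1 - 2 * t) / 2) - η / (2 * (1 - 2 * t))) := by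
    intro t ht
    obtain ⟨x, rfl⟩ : ∃ x, t = (1 - x) / 2 := ⟨1 - 2 * t, by ring⟩
    rw [show 1 - 2 * ((1 - x) / 2) = x by ring] at ht ⊢
    field_simp
    ring
  refine ⟨by linarith, fun t ht => ?_⟩
  have htpos : 0 < 1 - 2 * t := by linarith
  rw [hsubst t htpos, hsubst tstar hypos]
  linarith [log_sub_inv_sub_linear_le_of_root hη.le ha.le htpos hypos hroot]
end

section
/- Let γ > 0, η > 0, N_R > 0 and N_s > 1 be real numbers, and assume γ < (2N_R + η)/(2N_R(N_s − 1)). Let x* > 0 be the unique positive solution of ((γ+1)/(η γ))·(x² − N_R²) − x − N_R − 2N_R(N_s − 1) = 0. Then x* > √(N_R² + 2 γ η N_R(N_s − 1)); equivalently, v* = (x*² − N_R²)/(η γ) > 2N_R(N_s − 1). -/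
/-- Key inequality for monotonicity of the rate function: when
`γ < (2N_R + η)/(2N_R(N_s−1))`, the positive root `x*` of
`((γ+1)/(ηγ))(x² − N_R²) − x − N_R − 2N_R(N_s−1) = 0` satisfies
`x* > √(N_R² + 2γη N_R(N_s−1))`; equivalently `v* = (x*² − N_R²)/(ηγ) > 2N_R(N_s−1)`. -/
theorem stmt_10 (γ η NR Ns : ℝ) (hγ : 0 < γ) (hη : 0 < η) (hNR : 0 < NR) (hNs : 1 < Ns)
    (hth : γ < (2 * NR + η) / (2 * NR * (Ns - 1)))
    (xstar : ℝ) (hx : 0 < xstar)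
    (hroot : (γ + 1) / (η * γ) * (xstar ^ 2 - NR ^ 2) - xstar - NR - 2 * NR * (Ns - 1) = 0) :
    Real.sqrt (NR ^ 2 + 2 * γ * η * NR * (Ns - 1)) < xstar ∧
    2 * NR * (Ns - 1) < (xstar ^ 2 - NR ^ 2) / (η * γ) := by
  have hA : 0 < 2 * NR * (Ns - 1) := by
    have : 0 < Ns - 1 := by linarith
    positivity
  have hηγ : 0 < η * γ := mul_pos hη hγ
  rw [lt_div_iff₀ hA] at hth
  have hv : xstar ^ 2 - NR ^ 2 = η * γ * ((xstar ^ 2 - NR ^ 2) / (η * γ)) := by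
    field_simp
  have hroot' : (γ + 1) * ((xstar ^ 2 - NR ^ 2) / (η * γ)) - xstar - NR
      - 2 * NR * (Ns - 1) = 0 := by
    rw [← hroot]; ring
  have key : 2 * NR * (Ns - 1) < (xstar ^ 2 - NR ^ 2) / (η * γ) := by
    generalize (xstar ^ 2 - NR ^ 2) / (η * γ) = v at hv hroot' ⊢
    generalize 2 * NR * (Ns - 1) = A at *
    by_contra! hle
    have hlt : xstar < NR + η := by nlinarith
    have hγv : xstar + NR ≤ γ * v := by linarith
    have hmul : η * (xstar + NR) ≤ (xstar - NR) * (xstar + NR) := by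
      nlinarith [mul_le_mul_of_nonneg_left hγv hη.le]
    have := le_of_mul_le_mul_right hmul (by linarith)
    linarith
  refine ⟨?_, key⟩
  rw [Real.sqrt_lt' hx]
  rw [lt_div_iff₀ hηγ] at key
  linarith
end

section
/- Let η > 0, N_R > 0, N_s > 1 and γ > 0 be real numbers. Define Λ(t₁, t₂) = η t₁/(1 − 2t₁) − N_R·log(1 − 2t₁) − N_R(N_s − 1)·log(1 − 2t₂) for t₁, t₂ < 1/2, and the rate function I_L(u, v) = sup_{t₁ < 1/2, t₂ < 1/2} [ t₁ u + t₂ v − Λ(t₁, t₂) ] for u, v > 0. If γ > (2N_R + η)/(2N_R(N_s − 1)), then inf { I_L(u, v) : u > 0, v > 0, u ≤ γ v } = 0. -/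
/-- The map `t ↦ a * t / (1 - 2 * t)` lies above its tangent line at `0`. -/
lemma mul_le_mul_div_one_sub_two_mul {a t : ℝ} (ha : 0 ≤ a) (ht : t < 1 / 2) :
    a * t ≤ a * t / (1 - 2 * t) := by
  have hs : 0 < 1 - 2 * t := by linarith
  rw [le_div_iff₀ hs]
  nlinarith [mul_nonneg ha (sq_nonneg t)]

/-- The map `t ↦ -c * log (1 - 2 * t)` lies above its tangent line at `0`. -/
lemma mul_log_one_sub_two_mul_le {c t : ℝ} (hc : 0 ≤ c) (ht : t < 1 / 2) :
    c * Real.log (1 - 2 * t) ≤ -(2 * c * t) := by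
  have hs : 0 < 1 - 2 * t := by linarith
  nlinarith [mul_le_mul_of_nonneg_left (Real.log_le_sub_one_of_pos hs) hc]

/-- Case 1 of the KKT analysis: when `γ > (2N_R + η)/(2N_R(N_s−1))`, the
constrained infimum of the Gartner–Ellis rate function
`I_L(u,v) = sup_{t₁,t₂<1/2}[t₁u + t₂v − Λ(t₁,t₂)]` over `{u,v>0, u ≤ γv}` is `0`. -/
theorem stmt_12 (η NR Ns γ : ℝ) (hη : 0 < η) (hNR : 0 < NR) (hNs : 1 < Ns) (hγ : 0 < γ)
    (hth : (2 * NR + η) / (2 * NR * (Ns - 1)) < γ) :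
    sInf {y : ℝ | ∃ u v : ℝ, 0 < u ∧ 0 < v ∧ u ≤ γ * v ∧
        y = sSup {x : ℝ | ∃ t₁ t₂ : ℝ, t₁ < 1 / 2 ∧ t₂ < 1 / 2 ∧
          x = t₁ * u + t₂ * v -
            (η * t₁ / (1 - 2 * t₁) - NR * Real.log (1 - 2 * t₁)
              - NR * (Ns - 1) * Real.log (1 - 2 * t₂))}} = 0 := by
  have hc : 0 < NR * (Ns - 1) := mul_pos hNR (by linarith)
  refine IsLeast.csInf_eq ⟨⟨2 * NR + η, 2 * NR * (Ns - 1), by positivity, by linarith, ?_, ?_⟩, ?_⟩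
  · exact ((div_lt_iff₀ (by linarith)).1 hth).le
  · symm
    refine IsGreatest.csSup_eq ⟨⟨0, 0, by norm_num, by norm_num, by simp⟩, ?_⟩
    rintro x ⟨t₁, t₂, h₁, h₂, rfl⟩
    linarith [mul_le_mul_div_one_sub_two_mul hη.le h₁,
      mul_log_one_sub_two_mul_le hNR.le h₁, mul_log_one_sub_two_mul_le hc.le h₂]
  · rintro y ⟨u, v, -, -, -, rfl⟩
    exact Real.sSup_nonneg' ⟨0, ⟨0, 0, by norm_num, by norm_num, by simp⟩, le_rfl⟩
end

section
/- Let η > 0, N_R > 0, N_s > 1 and γ > 0 be real numbers with γ < (2N_R + η)/(2N_R(N_s − 1)). Define Λ(t₁, t₂) = η t₁/(1 − 2t₁) − N_R·log(1 − 2t₁) − N_R(N_s − 1)·log(1 − 2t₂) for t₁, t₂ < 1/2, and I_L(u, v) = sup_{t₁ < 1/2, t₂ < 1/2} [ t₁ u + t₂ v − Λ(t₁, t₂) ] for u, v > 0. Let x* > 0 be the unique positive root of ((γ+1)/(η γ))(x² − N_R²) − x − N_R − 2N_R(N_s − 1) = 0 and set v* = (x*² − N_R²)/(η γ). Then inf {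 I_L(u, v) : u > 0, v > 0, u ≤ γ v } = (η/2)·(1 − γ v*/(N_R + √(N_R² + γ η v*))) + N_R(N_s − 1)·log( 2N_R(N_s − 1)/v* ) − N_R·log( γ v*/(N_R + √(N_R² + γ η v*)) ). -/
/-- A critical point `a` (in the variable `1 - 2 * t`) of the concave function
`t ↦ t * u - (η * t / (1 - 2 * t) - N * log (1 - 2 * t))` is a global maximiser. -/
lemma legendre_le_of_critical {η N u a t : ℝ} (hη : 0 ≤ η) (hN : 0 ≤ N) (ha : 0 < a)
    (hcrit : u * a ^ 2 = 2 * N * a + η) (ht : t < 1 / 2) :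
    t * u - (η * t / (1 - 2 * t) - N * Real.log (1 - 2 * t))
      ≤ (1 - a) / 2 * u - (η * ((1 - a) / 2) / a - N * Real.log a) := by
  obtain ⟨b, hb⟩ : ∃ b, b = 1 - 2 * t := ⟨_, rfl⟩
  have hb0 : 0 < b := by linarith
  obtain rfl : t = (1 - b) / 2 := by linarith
  rw [← hb]
  have hlog : N * (Real.log b - Real.log a) ≤ N * (b / a - 1) := by
    rw [← Real.log_div hb0.ne' ha.ne']
    exact mul_le_mul_of_nonneg_left (Real.log_le_sub_one_of_pos (div_pos hb0 ha)) hN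
  have hu : u = (2 * N * a + η) / a ^ 2 := by
    rw [← hcrit]; field_simp
  have hgap : (1 - a) / 2 * u - η * ((1 - a) / 2) / a
      - ((1 - b) / 2 * u - η * ((1 - b) / 2) / b) - N * (b / a - 1)
      = η * (b - a) ^ 2 / (2 * a ^ 2 * b) := by
    rw [hu]; field_simp; ring
  have hgap_nonneg : 0 ≤ η * (b - a) ^ 2 / (2 * a ^ 2 * b) := by positivity
  linarith


/-- Case 2 of the KKT analysis (Eq. (rate_L)): when `γ < (2N_R + η)/(2N_R(N_s−1))`,
the constrained infimum of the Gartner–Ellis rate function over `{u,v>0, u ≤ γv}`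
equals the closed-form rate function `I*(η,γ)` expressed through
`v* = (x*² − N_R²)/(ηγ)`, where `x*` is the positive root of Eq. (eq_L_x). -/
theorem stmt_13 (η NR Ns γ : ℝ) (hη : 0 < η) (hNR : 0 < NR) (hNs : 1 < Ns) (hγ : 0 < γ)
    (hth : γ < (2 * NR + η) / (2 * NR * (Ns - 1)))
    (xstar : ℝ) (hx : 0 < xstar)
    (hroot : (γ + 1) / (η * γ) * (xstar ^ 2 - NR ^ 2) - xstar - NR - 2 * NR * (Ns - 1) = 0)
    (vstar : ℝ) (hv : vstar = (xstar ^ 2 - NR ^ 2) / (η * γ)) :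
    sInf {y : ℝ | ∃ u v : ℝ, 0 < u ∧ 0 < v ∧ u ≤ γ * v ∧
        y = sSup {x : ℝ | ∃ t₁ t₂ : ℝ, t₁ < 1 / 2 ∧ t₂ < 1 / 2 ∧
          x = t₁ * u + t₂ * v -
            (η * t₁ / (1 - 2 * t₁) - NR * Real.log (1 - 2 * t₁)
              - NR * (Ns - 1) * Real.log (1 - 2 * t₂))}}
      = η / 2 * (1 - γ * vstar / (NR + Real.sqrt (NR ^ 2 + γ * η * vstar)))
        + NR * (Ns - 1) * Real.log (2 * NR * (Ns - 1) / vstar)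
        - NR * Real.log (γ * vstar / (NR + Real.sqrt (NR ^ 2 + γ * η * vstar))) := by
  obtain ⟨M, hM⟩ : ∃ M, M = NR * (Ns - 1) := ⟨_, rfl⟩
  have hM0 : 0 < M := hM ▸ mul_pos hNR (sub_pos.2 hNs)
  rw [mul_assoc 2 NR, ← hM] at hth hroot ⊢
  have hsq : xstar ^ 2 - NR ^ 2 = η * γ * vstar := by rw [hv]; field_simp
  have hlin : (γ + 1) * vstar = xstar + NR + 2 * M := by
    rw [hsq] at hroot
    field_simp at hroot
    linarith
  have hv0 : 0 < vstar := by
    refine pos_of_mul_pos_right (a := γ + 1) ?_ (by positivity)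
    rw [hlin]; positivity
  have hsqrt : Real.sqrt (NR ^ 2 + γ * η * vstar) = xstar := by
    rw [show NR ^ 2 + γ * η * vstar = xstar ^ 2 by linarith, Real.sqrt_sq hx.le]
  rw [hsqrt]
  -- The supremum defining the rate function is bounded by its value at a critical point.
  have hbound : ∀ {u v a b : ℝ}, 0 < a → 0 < b → u * a ^ 2 = 2 * NR * a + η → v * b = 2 * M →
      ∀ t₁ t₂ : ℝ, t₁ < 1 / 2 → t₂ < 1 / 2 →
      t₁ * u + t₂ * v - (η * t₁ / (1 - 2 * t₁) - NR * Real.log (1 - 2 * t₁)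
        - M * Real.log (1 - 2 * t₂)) ≤
      (1 - a) / 2 * u + (1 - b) / 2 * v - (η * ((1 - a) / 2) / a - NR * Real.log a
        - M * Real.log b) := by
    intro u v a b ha hb hua hvb t₁ t₂ h₁ h₂
    have e₁ := legendre_le_of_critical hη.le hNR.le ha hua h₁
    have e₂ := legendre_le_of_critical (u := v) le_rfl hM0.le hb
      (by rw [sq, ← mul_assoc, hvb, add_zero]) h₂
    simp only [zero_mul, zero_div, zero_sub] at e₂
    linarith
  set a := (NR + xstar) / (γ * vstar) with ha
  set b := 2 * M / vstar with hb
  have ha0 : 0 < a := by positivity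
  have hb0 : 0 < b := by positivity
  have hav : a * (γ * vstar) = NR + xstar := by rw [ha]; field_simp
  have hbv : vstar * b = 2 * M := by rw [hb]; field_simp
  have hcrit : γ * vstar * a ^ 2 = 2 * NR * a + η := by
    refine mul_right_cancel₀ (mul_pos hγ hv0).ne' ?_
    linear_combination (a * (γ * vstar) + NR + xstar - 2 * NR) * hav + hsq
  have ha1 : 1 ≤ a := by
    by_contra! h
    have h₁ : NR + xstar < γ * vstar := by
      rw [← hav]; exact mul_lt_of_lt_one_left (by positivity) h
    have h₂ : vstar < 2 * M := by linarith
    have h₃ : NR + η < xstar := by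
      by_contra! h'
      nlinarith [mul_lt_mul_of_pos_left h₁ hη,
        mul_nonneg (sub_nonneg.2 h') (add_pos hNR hx).le]
    rw [lt_div_iff₀ (by positivity)] at hth
    linarith [mul_lt_mul_of_pos_left h₂ hγ]
  have horth : γ * (1 - a) + (1 - b) = 0 := by
    refine mul_right_cancel₀ hv0.ne' ?_
    linear_combination hlin - hav - hbv
  have hinv : γ * vstar / (NR + xstar) = a⁻¹ := by rw [ha, inv_div]
  rw [hinv, Real.log_inv]
  have hval : η / 2 * (1 - a⁻¹) + M * Real.log b - NR * -Real.log a
      = -(η * ((1 - a) / 2) / a - NR * Real.log a - M * Real.log b) := by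
    field_simp; ring
  rw [hval]
  refine IsLeast.csInf_eq ⟨⟨γ * vstar, vstar, by positivity, hv0, le_rfl, ?_⟩, ?_⟩
  · symm
    have hzero : (1 - a) / 2 * (γ * vstar) + (1 - b) / 2 * vstar = 0 := by
      linear_combination vstar / 2 * horth
    refine IsGreatest.csSup_eq ⟨⟨(1 - a) / 2, (1 - b) / 2, by linarith, by linarith, ?_⟩, ?_⟩
    · rw [hzero, show 1 - 2 * ((1 - a) / 2) = a by ring, show 1 - 2 * ((1 - b) / 2) = b by ring,
        zero_sub]
    · rintro _ ⟨t₁, t₂, h₁, h₂, rfl⟩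
      have := hbound ha0 hb0 hcrit hbv t₁ t₂ h₁ h₂
      rwa [hzero, zero_sub] at this
  · rintro _ ⟨u, v, hu, hv', huv, rfl⟩
    have hbdd : BddAbove {x : ℝ | ∃ t₁ t₂ : ℝ, t₁ < 1 / 2 ∧ t₂ < 1 / 2 ∧
        x = t₁ * u + t₂ * v - (η * t₁ / (1 - 2 * t₁) - NR * Real.log (1 - 2 * t₁)
          - M * Real.log (1 - 2 * t₂))} := by
      have hs := Real.sq_sqrt (show 0 ≤ NR ^ 2 + u * η by positivity)
      have hs0 := Real.sqrt_nonneg (NR ^ 2 + u * η)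
      set s := Real.sqrt (NR ^ 2 + u * η)
      have hcrit' : u * ((NR + s) / u) ^ 2 = 2 * NR * ((NR + s) / u) + η := by
        field_simp
        linear_combination hs
      have hle := hbound (by positivity) (show 0 < 2 * M / v by positivity) hcrit'
        (mul_div_cancel₀ (2 * M) hv'.ne')
      exact ⟨_, by rintro _ ⟨t₁, t₂, h₁, h₂, rfl⟩; exact hle t₁ t₂ h₁ h₂⟩
    refine le_trans ?_ (le_csSup hbdd
      ⟨(1 - a) / 2, (1 - b) / 2, by linarith, by linarith, rfl⟩)
    rw [show 1 - 2 * ((1 - a) / 2) = a by ring, show 1 - 2 * ((1 - b) / 2) = b by ring]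
    have hlin_nonneg : 0 ≤ (1 - a) / 2 * u + (1 - b) / 2 * v := by
      rw [show (1 - a) / 2 * u + (1 - b) / 2 * v = (a - 1) * (γ * v - u) / 2 by
        linear_combination v / 2 * horth]
      exact div_nonneg (mul_nonneg (sub_nonneg.2 ha1) (sub_nonneg.2 huv)) zero_le_two
    linarith
end

section
/- Let N_R, N_s be integers with N_R ≥ 1 and N_s ≥ 2, let η > 0 and γ > 0 be real numbers with γ < (2N_R + η)/(2N_R(N_s − 1)). For each integer L ≥ 1, let (X_i)_{i=1}^{2N_R L} and (Y_j)_{j=1}^{2N_R(N_s−1)L} be independent standard real Gaussian random variables and set p_L = P( (√(Lη) + X₁)² + Σ_{i=2}^{2N_R L} X_i² ≤ γ · Σ_{j=1}^{2N_R(N_s−1)L} Y_j² ). Then lim_{L→∞} −(1/L)·log p_L = I*(η, γ), where I*(η, γ) = inf { sup_{t₁ < 1/2, t₂ < 1/2} [ t₁ u + t₂ v − η t₁/(1 − 2t₁) + N_R·log(1 − 2t₁) + N_R(N_s − 1)·log(1 − 2t₂) ] : u > 0, v > 0, u ≤ γ v }. -/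
open MeasureTheory ProbabilityTheory
open scoped BigOperators

/-- The miss-detection probability `p_L = P((√(Lη) + X₁)² + Σᵢ Xᵢ² ≤ γ Σⱼ Yⱼ²)`,
where the `Xᵢ` (`2N_R L` of them) and `Yⱼ` (`2N_R(N_s−1)L` of them) are
independent standard real Gaussians. -/
noncomputable def missProb (NR Ns L : ℕ) (η γ : ℝ) : ℝ :=
  ((Measure.prod
      (Measure.pi fun _ : Fin (2 * NR * L) => gaussianReal 0 1)
      (Measure.pi fun _ : Fin (2 * NR * (Ns - 1) * L) => gaussianReal 0 1))
    {xy : (Fin (2 * NR * L) → ℝ) × (Fin (2 * NR * (Ns - 1) * L) → ℝ) |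
      ∑ i : Fin (2 * NR * L),
          ((if i.val = 0 then Real.sqrt (L * η) else 0) + xy.1 i) ^ 2
        ≤ γ * ∑ j : Fin (2 * NR * (Ns - 1) * L), (xy.2 j) ^ 2}).toReal

/-- The large-deviations rate function `I*(η,γ)` of Proposition 3. -/
noncomputable def rateFn (NR Ns γ η : ℝ) : ℝ :=
  sInf {y : ℝ | ∃ u v : ℝ, 0 < u ∧ 0 < v ∧ u ≤ γ * v ∧
    y = sSup {x : ℝ | ∃ t₁ t₂ : ℝ, t₁ < 1 / 2 ∧ t₂ < 1 / 2 ∧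
      x = t₁ * u + t₂ * v - η * t₁ / (1 - 2 * t₁) + NR * Real.log (1 - 2 * t₁)
        + NR * (Ns - 1) * Real.log (1 - 2 * t₂)}}

/-- The negative cumulant generating function of a squared-Gaussian sum: the negative logarithm of
the moment generating function of a noncentral chi-square variable with `2 * n` degrees of freedom
and noncentrality `η`. -/
noncomputable def negCgf (η n t : ℝ) : ℝ := -(η * t / (1 - 2 * t)) + n * Real.log (1 - 2 * t)

/-- The mean of the noncentral chi-square variable tilted by `t`. -/
noncomputable def tiltedMean (η n t : ℝ) : ℝ := η / (1 - 2 * t) ^ 2 + 2 * n / (1 - 2 * t)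

theorem hasDerivAt_negCgf (η n : ℝ) {t : ℝ} (ht : t < 1 / 2) :
    HasDerivAt (negCgf η n) (-tiltedMean η n t) t := by
  have h0 : 1 - 2 * t ≠ 0 := by linarith
  have h1 : HasDerivAt (fun t : ℝ => 1 - 2 * t) (-2) t := by
    simpa using ((hasDerivAt_id t).const_mul 2).const_sub 1
  have h2 : HasDerivAt (fun t : ℝ => η * t) η t := by
    simpa using (hasDerivAt_id t).const_mul η
  refine ((h2.div h1 h0).neg.add ((h1.log h0).const_mul n)).congr_deriv ?_
  unfold tiltedMean
  field_simp
  ring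

theorem continuousAt_tiltedMean (η n : ℝ) {t : ℝ} (ht : t < 1 / 2) :
    ContinuousAt (tiltedMean η n) t := by
  have h0 : 1 - 2 * t ≠ 0 := by linarith
  unfold tiltedMean
  fun_prop (disch := first | exact h0 | exact pow_ne_zero 2 h0)

/-- Strict concavity of `negCgf`: it lies below its tangents. -/
theorem negCgf_add_lt {η n s t : ℝ} (hη : 0 ≤ η) (hn : 0 < n) (hs : s < 1 / 2) (ht : t < 1 / 2)
    (hst : s ≠ t) :
    negCgf η n s + tiltedMean η n t * s < negCgf η n t + tiltedMean η n t * t := by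
  obtain ⟨A, rfl⟩ : ∃ A, s = (1 - A) / 2 := ⟨1 - 2 * s, by ring⟩
  obtain ⟨B, rfl⟩ : ∃ B, t = (1 - B) / 2 := ⟨1 - 2 * t, by ring⟩
  have hA : 0 < A := by linarith
  have hB : 0 < B := by linarith
  have hAB : A ≠ B := fun h => hst (by rw [h])
  have e : ∀ C : ℝ, 1 - 2 * ((1 - C) / 2) = C := fun C => by ring
  simp only [negCgf, tiltedMean, e]
  have hlog : Real.log A - Real.log B < A / B - 1 := by
    rw [← Real.log_div hA.ne' hB.ne']
    exact Real.log_lt_sub_one_of_pos (by positivity) fun h => hAB ((div_eq_one_iff_eq hB.ne').1 h)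
  have hlog' := mul_lt_mul_of_pos_left hlog hn
  have hsq : 0 ≤ η * (A - B) ^ 2 / (2 * A * B ^ 2) := by positivity
  have key : -(η * ((1 - B) / 2) / B) + (η / B ^ 2 + 2 * n / B) * ((1 - B) / 2)
      - (-(η * ((1 - A) / 2) / A) + (η / B ^ 2 + 2 * n / B) * ((1 - A) / 2))
      = η * (A - B) ^ 2 / (2 * A * B ^ 2) + n * (A / B - 1) := by
    field_simp
    ring
  linarith

theorem negCgf_add_le {η n s t : ℝ} (hη : 0 ≤ η) (hn : 0 < n) (hs : s < 1 / 2) (ht : t < 1 / 2) :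
    negCgf η n s + tiltedMean η n t * s ≤ negCgf η n t + tiltedMean η n t * t := by
  rcases eq_or_ne s t with rfl | hst
  · rfl
  · exact (negCgf_add_lt hη hn hs ht hst).le

theorem negCgf_add_mul_le {η n u t : ℝ} (hη : 0 ≤ η) (hn : 0 < n) (hu : 0 < u) (ht : t < 1 / 2) :
    negCgf η n t + u * t ≤ η / 2 + u / 2 - n - n * Real.log (u / (2 * n)) := by
  obtain ⟨A, rfl⟩ : ∃ A, t = (1 - A) / 2 := ⟨1 - 2 * t, by ring⟩
  have hA : 0 < A := by linarith
  have hlog := Real.log_le_sub_one_of_pos (show 0 < A * (u / (2 * n)) by positivity)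
  rw [Real.log_mul hA.ne' (by positivity)] at hlog
  have hlog' := mul_le_mul_of_nonneg_left hlog hn.le
  have e : n * (A * (u / (2 * n)) - 1) = u * A / 2 - n := by
    field_simp
  have e' : η * ((1 - A) / 2) / A = η / (2 * A) - η / 2 := by
    field_simp
  have : 0 ≤ η / (2 * A) := by positivity
  rw [negCgf, show 1 - 2 * ((1 - A) / 2) = A by ring]
  linarith

theorem integral_exp_mul_add_sq_gaussianReal (b : ℝ) {t : ℝ} (ht : t < 1 / 2) :
    ∫ x, Real.exp (t * (b + x) ^ 2) ∂gaussianReal 0 1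
      = Real.exp (b ^ 2 * t / (1 - 2 * t) - 1 / 2 * Real.log (1 - 2 * t)) := by
  have h0 : 0 < 1 - 2 * t := by linarith
  rw [integral_gaussianReal_eq_integral_smul one_ne_zero]
  have e : ∀ x : ℝ, gaussianPDFReal 0 1 x • Real.exp (t * (b + x) ^ 2)
      = ((√(2 * Real.pi))⁻¹ * Real.exp (b ^ 2 * t / (1 - 2 * t)))
        * Real.exp (-((1 - 2 * t) / 2) * (x - 2 * t * b / (1 - 2 * t)) ^ 2) := by
    intro x
    simp only [gaussianPDFReal, smul_eq_mul, NNReal.coe_one, mul_one, sub_zero]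
    rw [mul_assoc, mul_assoc, ← Real.exp_add, ← Real.exp_add]
    congr 2
    field_simp
    ring
  simp only [e]
  rw [integral_const_mul,
    integral_sub_right_eq_self (fun x => Real.exp (-((1 - 2 * t) / 2) * x ^ 2)), integral_gaussian,
    Real.exp_sub, mul_comm (1 / 2 : ℝ), ← Real.rpow_def_of_pos h0, ← Real.sqrt_eq_rpow,
    show Real.pi / ((1 - 2 * t) / 2) = 2 * Real.pi / (1 - 2 * t) by field_simp,
    Real.sqrt_div (by positivity)]
  have : √(2 * Real.pi) ≠ 0 := by positivity
  field_simp

theorem integral_exp_mul_sum_add_sq_gaussianReal {ι : Type*} [Fintype ι] (b : ι → ℝ) {t : ℝ}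
    (ht : t < 1 / 2) :
    ∫ x, Real.exp (t * ∑ i, (b i + x i) ^ 2) ∂Measure.pi (fun _ : ι => gaussianReal 0 1)
      = Real.exp (-negCgf (∑ i, b i ^ 2) (Fintype.card ι / 2) t) := by
  simp only [Finset.mul_sum, Real.exp_sum]
  rw [integral_fintype_prod_eq_prod (fun i x => Real.exp (t * (b i + x) ^ 2))]
  simp only [integral_exp_mul_add_sq_gaussianReal _ ht, ← Real.exp_sum]
  simp only [Finset.sum_sub_distrib, Finset.sum_const, Finset.card_univ, nsmul_eq_mul,
    ← Finset.sum_div, ← Finset.sum_mul, negCgf]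
  congr 1
  ring

/-- A Chernoff bound and its matching lower bound: if the moment generating functions of `D L` are
`exp (-L * g)` near a point `s` at which `g` has a local maximum, strict to the right, then
`P (0 ≤ D L)` decays exponentially at rate `g s`. -/
theorem tendsto_neg_log_measureReal_nonneg_of_mgf {Ω : ℕ → Type*} [∀ L, MeasurableSpace (Ω L)]
    (μ : ∀ L, Measure (Ω L)) [∀ L, IsProbabilityMeasure (μ L)] (D : ∀ L, Ω L → ℝ)
    (hD : ∀ L, Measurable (D L)) {g g' : ℝ → ℝ} {s : ℝ} (hs : 0 < s)
    (hmgf : ∀ᶠ t in nhds s, ∀ L, 1 ≤ L → mgf (D L) (μ L) t = Real.exp (-(L * g t)))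
    (hg : ∀ᶠ t in nhds s, HasDerivAt g (g' t) t) (hg' : ContinuousAt g' s) (hgs : g' s = 0)
    (hlt : ∀ᶠ t in nhdsWithin s (Set.Ioi s), g t < g s) :
    Filter.Tendsto (fun L : ℕ => -(1 / (L : ℝ)) * Real.log ((μ L).real {ω | 0 ≤ D L ω}))
      Filter.atTop (nhds (g s)) := by
  have hint : ∀ t : ℝ, ∀ L : ℕ, mgf (D L) (μ L) t = Real.exp (-(L * g t)) →
      Integrable (fun ω => Real.exp (t * D L ω)) (μ L) := fun t L h =>
    Integrable.of_integral_ne_zero (by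
      change mgf (D L) (μ L) t ≠ 0
      rw [h]
      positivity)
  have upper : ∀ L : ℕ, 1 ≤ L → (μ L).real {ω | 0 ≤ D L ω} ≤ Real.exp (-(L * g s)) := by
    intro L hL
    have h := hmgf.self_of_nhds L hL
    simpa [h] using measure_ge_le_exp_mul_mgf 0 hs.le (hint s L h)
  have lower : ∀ δ > 0, ∀ᶠ L : ℕ in Filter.atTop,
      1 / 2 * Real.exp (-(L * (g s + (s + 1) * δ))) ≤ (μ L).real {ω | 0 ≤ D L ω} := by
    intro δ hδ
    have hd : ∀ᶠ t in nhds s, -δ < g' t :=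
      hg'.eventually (lt_mem_nhds (by rw [hgs]; linarith))
    obtain ⟨t, ⟨⟨⟨⟨htd, htg⟩, htm⟩, ht1⟩, htlt⟩, hst⟩ :=
      (((((hd.and hg).and hmgf.eventually_nhds).and
        (gt_mem_nhds (lt_add_one s))).filter_mono nhdsWithin_le_nhds |>.and hlt).and
          (self_mem_nhdsWithin : Set.Ioi s ∈ nhdsWithin s (Set.Ioi s))).exists
    have hst' : s < t := hst
    have hslope_tendsto : Filter.Tendsto (slope g t) (nhdsWithin t (Set.Ioi t)) (nhds (g' t)) :=
      (hasDerivAt_iff_tendsto_slope.1 htg).mono_left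
        (nhdsWithin_mono t fun x (hx : t < x) => hx.ne')
    obtain ⟨r, ⟨hr, hrm⟩, htr⟩ :=
      ((hslope_tendsto.eventually (lt_mem_nhds htd)).and
        (htm.filter_mono nhdsWithin_le_nhds) |>.and
          (self_mem_nhdsWithin : Set.Ioi t ∈ nhdsWithin t (Set.Ioi t))).exists
    have htr' : t < r := htr
    have hslope : g t < g r + (r - t) * δ := by
      rw [slope_def_field, lt_div_iff₀ (by linarith)] at hr
      linarith
    have hdecay : ∀ c : ℝ, 0 < c → ∀ᶠ L : ℕ in Filter.atTop, Real.exp (-(L * c)) < 1 / 4 := by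
      intro c hc
      exact Filter.Tendsto.eventually_lt_const (by norm_num)
        (Real.tendsto_exp_neg_atTop_nhds_zero.comp (tendsto_natCast_atTop_atTop.atTop_mul_const hc))
    filter_upwards [hdecay (g s - g t) (by linarith), hdecay (g r + (r - t) * δ - g t) (by linarith),
      Filter.eventually_ge_atTop 1] with L h1 h2 hL
    have es := hmgf.self_of_nhds L hL
    have et := htm.self_of_nhds L hL
    have er := hrm L hL
    have hset : MeasurableSet {ω | 0 ≤ D L ω} := measurableSet_le measurable_const (hD L)
    have hpt : ∀ ω, Real.exp (t * D L ω) ≤ Real.exp (s * D L ω)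
        + Real.exp (-((r - t) * (L * δ))) * Real.exp (r * D L ω)
        + Real.exp (t * (L * δ)) * Set.indicator {ω | 0 ≤ D L ω} 1 ω := by
      intro ω
      by_cases h0 : 0 ≤ D L ω
      · rw [Set.indicator_of_mem (by exact h0), Pi.one_apply, mul_one, ← Real.exp_add]
        rcases le_total (D L ω) (L * δ) with h | h
        · have : Real.exp (t * D L ω) ≤ Real.exp (t * (L * δ)) :=
            Real.exp_le_exp.2 (mul_le_mul_of_nonneg_left h (by linarith))
          have := Real.exp_pos (s * D L ω)
          have := Real.exp_pos (-((r - t) * (L * δ)) + r * D L ω)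
          linarith
        · have : Real.exp (t * D L ω) ≤ Real.exp (-((r - t) * (L * δ)) + r * D L ω) :=
            Real.exp_le_exp.2 (by nlinarith)
          have := Real.exp_pos (s * D L ω)
          have := Real.exp_pos (t * (L * δ))
          linarith
      · rw [Set.indicator_of_notMem (by exact h0), mul_zero, add_zero]
        have : Real.exp (t * D L ω) ≤ Real.exp (s * D L ω) := Real.exp_le_exp.2 (by nlinarith)
        have : 0 < Real.exp (-((r - t) * (L * δ))) * Real.exp (r * D L ω) := by positivity
        linarith
    have i1 := hint s L es
    have i2 := (hint r L er).const_mul (Real.exp (-((r - t) * (L * δ))))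
    have i0 : Integrable (Set.indicator {ω | 0 ≤ D L ω} (1 : Ω L → ℝ)) (μ L) :=
      (integrable_const (1 : ℝ)).indicator hset
    have i3 := i0.const_mul (Real.exp (t * (L * δ)))
    have hI := integral_mono (hint t L et) ((i1.add i2).add i3) hpt
    simp only [Pi.add_apply] at hI
    rw [integral_add (by exact i1.add i2) i3, integral_add i1 i2, integral_const_mul,
      integral_const_mul, integral_indicator_one hset] at hI
    change mgf (D L) (μ L) t ≤ mgf (D L) (μ L) s + _ * mgf (D L) (μ L) r + _ at hI
    rw [es, et, er] at hI
    have b1 : Real.exp (-(L * g s)) ≤ 1 / 4 * Real.exp (-(L * g t)) := by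
      have := mul_le_mul_of_nonneg_right h1.le (Real.exp_pos (-(L * g t))).le
      rw [← Real.exp_add] at this
      refine le_of_eq_of_le (congrArg Real.exp ?_) this
      ring
    have b2 : Real.exp (-((r - t) * (L * δ))) * Real.exp (-(L * g r))
        ≤ 1 / 4 * Real.exp (-(L * g t)) := by
      have := mul_le_mul_of_nonneg_right h2.le (Real.exp_pos (-(L * g t))).le
      rw [← Real.exp_add] at this ⊢
      refine le_of_eq_of_le (congrArg Real.exp ?_) this
      ring
    have b3 : 1 / 2 * Real.exp (-(L * g t))
        ≤ Real.exp (t * (L * δ)) * (μ L).real {ω | 0 ≤ D L ω} := by linarith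
    have hL0 : (0 : ℝ) < L := by exact_mod_cast hL
    have b4 : Real.exp (-(L * (g s + (s + 1) * δ)))
        ≤ Real.exp (-(t * (L * δ))) * Real.exp (-(L * g t)) := by
      rw [← Real.exp_add]
      refine Real.exp_le_exp.2 ?_
      have := mul_le_mul_of_nonneg_left htlt.le hL0.le
      have := mul_le_mul_of_nonneg_right ht1.le (mul_pos hL0 hδ).le
      linarith
    calc 1 / 2 * Real.exp (-(L * (g s + (s + 1) * δ)))
        ≤ Real.exp (-(t * (L * δ))) * (1 / 2 * Real.exp (-(L * g t))) := by linarith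
      _ ≤ Real.exp (-(t * (L * δ))) * (Real.exp (t * (L * δ)) * (μ L).real {ω | 0 ≤ D L ω}) :=
          mul_le_mul_of_nonneg_left b3 (Real.exp_pos _).le
      _ = (μ L).real {ω | 0 ≤ D L ω} := by
          rw [← mul_assoc, ← Real.exp_add, neg_add_cancel, Real.exp_zero, one_mul]
  rw [Metric.tendsto_atTop']
  intro ε hε
  have hδ : 0 < ε / (2 * (s + 1)) := by positivity
  have hlog2 : ∀ᶠ L : ℕ in Filter.atTop, Real.log 2 / L < ε / 2 :=
    (tendsto_const_div_atTop_nhds_zero_nat _).eventually_lt_const (by positivity)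
  refine Filter.eventually_atTop.1 ?_ |>.imp fun a h n hn => h n hn.le
  filter_upwards [lower _ hδ, hlog2, Filter.eventually_ge_atTop 1] with L hlow h2 hL
  have hL0 : (0 : ℝ) < L := by exact_mod_cast hL
  have hp : 0 < (μ L).real {ω | 0 ≤ D L ω} := lt_of_lt_of_le (by positivity) hlow
  have l1 := Real.log_le_log hp (upper L hL)
  have l2 := Real.log_le_log (by positivity) hlow
  rw [Real.log_exp] at l1
  rw [Real.log_mul (by norm_num) (Real.exp_pos _).ne', Real.log_exp, one_div, Real.log_inv,
    show (s + 1) * (ε / (2 * (s + 1))) = ε / 2 by field_simp] at l2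
  rw [div_lt_iff₀ hL0] at h2
  rw [Real.dist_eq, show -(1 / (L : ℝ)) * Real.log ((μ L).real {ω | 0 ≤ D L ω}) - g s
    = (-Real.log ((μ L).real {ω | 0 ≤ D L ω}) - L * g s) / L by field_simp, abs_lt,
    lt_div_iff₀ hL0, div_lt_iff₀ hL0]
  constructor <;> nlinarith

/-- The decay rate is the value of the dual problem at a saddle point. -/
theorem rateFn_eq_of_tiltedMean_eq {NR Ns γ η s : ℝ} (hNR : 0 < NR) (hNs : 1 < Ns) (hη : 0 ≤ η)
    (hs : 0 ≤ s) (hγs : γ * s < 1 / 2)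
    (h : tiltedMean η NR (-s) = γ * tiltedMean 0 (NR * (Ns - 1)) (γ * s)) :
    rateFn NR Ns γ η = negCgf η NR (-s) + negCgf 0 (NR * (Ns - 1)) (γ * s) := by
  have hm : 0 < NR * (Ns - 1) := mul_pos hNR (by linarith)
  have hs' : -s < 1 / 2 := by linarith
  have mean_pos : ∀ {η n t : ℝ}, 0 ≤ η → 0 < n → t < 1 / 2 → 0 < tiltedMean η n t := by
    intro η n t hη hn ht
    have : 0 < 1 - 2 * t := by linarith
    unfold tiltedMean
    positivity
  have e : ∀ u v t₁ t₂ : ℝ, t₁ * u + t₂ * v - η * t₁ / (1 - 2 * t₁) + NR * Real.log (1 - 2 * t₁)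
      + NR * (Ns - 1) * Real.log (1 - 2 * t₂)
      = (negCgf η NR t₁ + u * t₁) + (negCgf 0 (NR * (Ns - 1)) t₂ + v * t₂) := by
    intro u v t₁ t₂
    simp only [negCgf]
    ring
  unfold rateFn
  simp only [e]
  have bound : ∀ {η n u : ℝ}, 0 ≤ η → 0 < n → 0 < u →
      ∃ C, ∀ t < 1 / 2, negCgf η n t + u * t ≤ C := fun hη hn hu =>
    ⟨_, fun t ht => negCgf_add_mul_le hη hn hu ht⟩
  refine IsLeast.csInf_eq ⟨⟨tiltedMean η NR (-s), tiltedMean 0 (NR * (Ns - 1)) (γ * s),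
    mean_pos hη hNR hs', mean_pos le_rfl hm hγs, h.le, ?_⟩, ?_⟩
  · symm
    refine IsGreatest.csSup_eq ⟨⟨-s, γ * s, hs', hγs, ?_⟩, ?_⟩
    · rw [h]
      ring
    · rintro _ ⟨t₁, t₂, h₁, h₂, rfl⟩
      have := negCgf_add_le hη hNR h₁ hs'
      have := negCgf_add_le le_rfl hm h₂ hγs
      have : tiltedMean η NR (-s) * -s + tiltedMean 0 (NR * (Ns - 1)) (γ * s) * (γ * s) = 0 := by
        rw [h]
        ring
      linarith
  · rintro _ ⟨u, v, hu, hv, huv, rfl⟩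
    obtain ⟨C₁, hC₁⟩ := bound hη hNR hu
    obtain ⟨C₂, hC₂⟩ := bound le_rfl hm hv
    refine le_trans ?_ (le_csSup ⟨C₁ + C₂, ?_⟩ ⟨-s, γ * s, hs', hγs, rfl⟩)
    · nlinarith
    · rintro _ ⟨t₁, t₂, h₁, h₂, rfl⟩
      exact add_le_add (hC₁ t₁ h₁) (hC₂ t₂ h₂)

/-- Below the threshold there is a positive saddle point. -/
theorem exists_tiltedMean_eq {n m η γ : ℝ} (hn : 0 < n) (hm : 0 < m) (hη : 0 ≤ η) (hγ : 0 < γ)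
    (h : γ * (2 * m) < 2 * n + η) :
    ∃ s, 0 < s ∧ γ * s < 1 / 2 ∧ tiltedMean η n (-s) = γ * tiltedMean 0 m (γ * s) := by
  set r := γ * (2 * m) / (2 * n + η) with hr
  have hr0 : 0 < r := by positivity
  have hr1 : r < 1 := (div_lt_one (by positivity)).2 h
  set b := (1 - r) / (2 * γ) with hb
  have hγb : γ * b = (1 - r) / 2 := by rw [hb]; field_simp
  have hb0 : 0 < b := by rw [hb]; apply div_pos <;> linarith
  have hlt : ∀ s ∈ Set.Icc 0 b, γ * s < 1 / 2 := fun s hs => by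
    have := mul_le_mul_of_nonneg_left hs.2 hγ.le
    linarith
  have hcont : ContinuousOn (fun s => tiltedMean η n (-s) - γ * tiltedMean 0 m (γ * s))
      (Set.Icc 0 b) := by
    intro s hs
    apply ContinuousAt.continuousWithinAt
    have h1 : ContinuousAt (fun s => tiltedMean η n (-s)) s :=
      (continuousAt_tiltedMean η n (by linarith [hs.1])).comp (f := fun s => -s) (by fun_prop)
    have h2 : ContinuousAt (fun s => tiltedMean 0 m (γ * s)) s :=
      (continuousAt_tiltedMean 0 m (hlt s hs)).comp (f := fun s => γ * s) (by fun_prop)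
    exact h1.sub (h2.const_mul γ)
  have hend : tiltedMean η n (-b) - γ * tiltedMean 0 m (γ * b) ≤ 0 := by
    have e : γ * tiltedMean 0 m (γ * b) = 2 * n + η := by
      rw [hγb, tiltedMean, show 1 - 2 * ((1 - r) / 2) = r by ring, hr]
      field_simp
      ring
    have h1 : 1 ≤ 1 - 2 * -b := by linarith
    have := div_le_self hη (one_le_pow₀ h1 (n := 2))
    have := div_le_self (by positivity : 0 ≤ 2 * n) h1
    rw [e, tiltedMean]
    linarith
  have hstart : 0 < tiltedMean η n (-0) - γ * tiltedMean 0 m (γ * 0) := by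
    simp [tiltedMean]
    linarith
  obtain ⟨s, hs, hs0⟩ := intermediate_value_Icc' hb0.le hcont ⟨hend, hstart.le⟩
  refine ⟨s, lt_of_le_of_ne hs.1 ?_, hlt s hs, sub_eq_zero.1 hs0⟩
  rintro rfl
  exact hstart.ne' hs0

/-- Main large-deviations claim (Eq. (LDP:L)) of Proposition 3, below the
threshold: if `γ < (2N_R + η)/(2N_R(N_s−1))`, then
`lim_{L→∞} −(1/L) log p_L = I*(η,γ)`. -/
theorem stmt_15 (NR Ns : ℕ) (hNR : 1 ≤ NR) (hNs : 2 ≤ Ns) (η γ : ℝ)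
    (hη : 0 < η) (hγ : 0 < γ)
    (hth : γ < (2 * (NR : ℝ) + η) / (2 * (NR : ℝ) * ((Ns : ℝ) - 1))) :
    Filter.Tendsto (fun L : ℕ => -(1 / (L : ℝ)) * Real.log (missProb NR Ns L η γ))
      Filter.atTop (nhds (rateFn NR ((Ns : ℝ)) γ η)) := by
  obtain ⟨k, rfl⟩ : ∃ k, Ns = k + 2 := ⟨Ns - 2, by omega⟩
  have hn : (0 : ℝ) < NR := by exact_mod_cast hNR
  have hNs1 : (1 : ℝ) < ((k + 2 : ℕ) : ℝ) := by exact_mod_cast hNs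
  set m : ℝ := NR * (((k + 2 : ℕ) : ℝ) - 1) with hm_def
  have hm : 0 < m := mul_pos hn (by linarith)
  rw [lt_div_iff₀ (by nlinarith)] at hth
  obtain ⟨s, hs, hγs, hmean⟩ := exists_tiltedMean_eq hn hm hη.le hγ (by linarith)
  rw [rateFn_eq_of_tiltedMean_eq hn hNs1 hη.le hs.le hγs hmean, ← hm_def]
  have hdom : ∀ᶠ t in nhds s, 0 < t ∧ γ * t < 1 / 2 :=
    (lt_mem_nhds hs).and
      ((continuous_const_mul γ).continuousAt.eventually (gt_mem_nhds hγs))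
  have hset : ∀ L, missProb NR (k + 2) L η γ = (Measure.prod
      (Measure.pi fun _ : Fin (2 * NR * L) => gaussianReal 0 1)
      (Measure.pi fun _ : Fin (2 * NR * (k + 2 - 1) * L) => gaussianReal 0 1)).real
      {xy | 0 ≤ γ * ∑ j, (xy.2 j) ^ 2
        - ∑ i, ((if i.val = 0 then Real.sqrt (L * η) else 0) + xy.1 i) ^ 2} := by
    intro L
    simp only [missProb, sub_nonneg, Measure.real]
  simp only [hset]
  refine tendsto_neg_log_measureReal_nonneg_of_mgf _ _ (fun L => by fun_prop)
    (g := fun t => negCgf η NR (-t) + negCgf 0 m (γ * t))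
    (g' := fun t => tiltedMean η NR (-t) - γ * tiltedMean 0 m (γ * t)) hs ?_ ?_ ?_
    (sub_eq_zero.2 hmean) ?_
  · filter_upwards [hdom] with t ht L hL
    have hL0 : (0 : ℝ) < L := by exact_mod_cast hL
    have hX := integral_exp_mul_sum_add_sq_gaussianReal
      (fun i : Fin (2 * NR * L) => if i.val = 0 then Real.sqrt (L * η) else 0)
      (show -t < 1 / 2 by linarith)
    have hY := integral_exp_mul_sum_add_sq_gaussianReal
      (fun _ : Fin (2 * NR * (k + 2 - 1) * L) => 0) ht.2
    have hsum : ∑ i : Fin (2 * NR * L), (if i.val = 0 then Real.sqrt (L * η) else 0) ^ 2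
        = L * η := by
      have hpos : 0 < 2 * NR * L := by positivity
      rw [Finset.sum_eq_single ⟨0, hpos⟩]
      · rw [if_pos rfl, Real.sq_sqrt (mul_pos hL0 hη).le]
      · intro i _ hi
        rw [if_neg fun h => hi (Fin.ext h)]
        simp
      · simp
    rw [hsum] at hX
    simp only [zero_add] at hY
    rw [mgf]
    calc _ = _ := integral_congr_ae (Filter.Eventually.of_forall fun xy => by
            change _ = Real.exp (-t * ∑ i, _) * Real.exp (γ * t * ∑ j, xy.2 j ^ 2)
            rw [← Real.exp_add]
            congr 1
            ring)
      _ = _ := integral_prod_mul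
            (fun x : Fin (2 * NR * L) → ℝ => Real.exp (-t *
              ∑ i, ((if i.val = 0 then Real.sqrt (L * η) else 0) + x i) ^ 2))
            (fun y : Fin (2 * NR * (k + 2 - 1) * L) → ℝ => Real.exp (γ * t * ∑ j, y j ^ 2))
      _ = _ := by
        rw [hX, hY, ← Real.exp_add, hm_def]
        simp only [negCgf, Fintype.card_fin]
        push_cast [show k + 2 - 1 = k + 1 by omega]
        congr 1
        simp
        ring
  · filter_upwards [hdom] with t ht
    have h1 := (hasDerivAt_negCgf η NR (show -t < 1 / 2 by linarith)).comp t (hasDerivAt_neg t)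
    have h2 := (hasDerivAt_negCgf 0 m ht.2).comp t
      (by simpa using (hasDerivAt_id t).const_mul γ : HasDerivAt (fun t => γ * t) γ t)
    exact (h1.add h2).congr_deriv (by ring)
  · have h1 : ContinuousAt (fun t => tiltedMean η NR (-t)) s :=
      (continuousAt_tiltedMean η NR (by linarith)).comp (f := fun t => -t) (by fun_prop)
    have h2 : ContinuousAt (fun t => tiltedMean 0 m (γ * t)) s :=
      (continuousAt_tiltedMean 0 m hγs).comp (f := fun t => γ * t) (by fun_prop)
    exact h1.sub (h2.const_mul γ)
  · filter_upwards [hdom.filter_mono nhdsWithin_le_nhds, self_mem_nhdsWithin] with t ht hst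
    have hst' : s < t := hst
    have h1 := negCgf_add_le hη.le hn (show -t < 1 / 2 by linarith) (show -s < 1 / 2 by linarith)
    have h2 := negCgf_add_lt le_rfl hm ht.2 hγs
      (mul_lt_mul_of_pos_left hst' hγ).ne'
    rw [hmean] at h1
    linarith
end

section
/- Let N_R, N_s be integers with N_R ≥ 1 and N_s ≥ 2, let η > 0 and γ > 0 be real numbers with γ > (2N_R + η)/(2N_R(N_s − 1)). For each integer L ≥ 1, let (X_i)_{i=1}^{2N_R L} and (Y_j)_{j=1}^{2N_R(N_s−1)L} be independent standard real Gaussian random variables and set p_L = P( (√(Lη) + X₁)² + Σ_{i=2}^{2N_R L} X_i² ≤ γ · Σ_{j=1}^{2N_R(N_s−1)L} Y_j² ). Then lim_{L→∞} −(1/L)·log p_L = 0. -/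
open MeasureTheory ProbabilityTheory
open scoped BigOperators

lemma memLp_sq_gaussianReal (m : ℝ) (v : NNReal) :
    MemLp (fun x : ℝ => x ^ 2) 2 (gaussianReal m v) := by
  have h4 : MemLp (id : ℝ → ℝ) 4 (gaussianReal m v) := memLp_id_gaussianReal' 4 (by simp)
  have hpqr : ENNReal.HolderTriple 4 4 2 := by
    refine ⟨?_⟩
    rw [← two_mul, show (4 : ENNReal) = 2 * 2 by norm_num,
      ENNReal.mul_inv (by simp) (by simp), ← mul_assoc,
      ENNReal.mul_inv_cancel (by simp) (by simp), one_mul]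
  simpa [sq] using h4.mul' h4 (hpqr := hpqr)

lemma memLp_const_mul_gaussianReal (m : ℝ) (v : NNReal) (a : ℝ) :
    MemLp (fun x : ℝ => a * x) 2 (gaussianReal m v) :=
  (memLp_id_gaussianReal' 2 (by simp)).const_mul a

lemma memLp_const_add_sq_gaussianReal (m : ℝ) (v : NNReal) (a : ℝ) :
    MemLp (fun x : ℝ => (a + x) ^ 2) 2 (gaussianReal m v) := by
  have h := (memLp_const (a ^ 2)).add
    ((memLp_const_mul_gaussianReal m v (2 * a)).add (memLp_sq_gaussianReal m v))
  convert h using 1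
  ext x
  simp only [Pi.add_apply]
  ring

lemma integral_const_add_sq_gaussianReal (a : ℝ) :
    ∫ x, (a + x) ^ 2 ∂gaussianReal 0 1 = a ^ 2 + 1 := by
  have hsq : ∫ x, x ^ 2 ∂gaussianReal 0 1 = 1 := by
    have h := variance_fun_id_gaussianReal (μ := 0) (v := 1)
    rw [variance_of_integral_eq_zero (by fun_prop) integral_id_gaussianReal] at h
    simpa using h
  have i1 := (memLp_const_mul_gaussianReal 0 1 (2 * a)).integrable (by norm_num)
  have i2 := (memLp_sq_gaussianReal 0 1).integrable (by norm_num)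
  calc ∫ x, (a + x) ^ 2 ∂gaussianReal 0 1
      = ∫ x, (a ^ 2 + (2 * a * x + x ^ 2)) ∂gaussianReal 0 1 := by
        congr 1; ext x; ring
    _ = a ^ 2 + 1 := by
        rw [integral_add (integrable_const _) (by exact i1.add i2), integral_add i1 i2,
          integral_const_mul, integral_id_gaussianReal, hsq]
        simp

lemma variance_add_le_two_mul {Ω : Type*} {mΩ : MeasurableSpace Ω} {μ : Measure Ω}
    [IsFiniteMeasure μ] {X Y : Ω → ℝ} (hX : MemLp X 2 μ) (hY : MemLp Y 2 μ) :
    Var[X + Y; μ] ≤ 2 * Var[X; μ] + 2 * Var[Y; μ] := by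
  have h := variance_nonneg (X - Y) μ
  rw [variance_sub hX hY] at h
  rw [variance_add hX hY]
  linarith

lemma variance_const_add_sq_gaussianReal_le (a : ℝ) :
    Var[fun x => (a + x) ^ 2; gaussianReal 0 1]
      ≤ 8 * a ^ 2 + 2 * Var[fun x => x ^ 2; gaussianReal 0 1] := by
  have h := variance_add_le_two_mul (memLp_const_mul_gaussianReal 0 1 (2 * a))
    (memLp_sq_gaussianReal 0 1)
  rw [variance_const_mul, variance_fun_id_gaussianReal] at h
  have e : (fun x : ℝ => (a + x) ^ 2)
      = fun x => a ^ 2 + ((fun x : ℝ => 2 * a * x) + fun x : ℝ => x ^ 2 : ℝ → ℝ) x := by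
    ext x; simp only [Pi.add_apply]; ring
  rw [e, variance_const_add (by fun_prop)]
  refine h.trans (le_of_eq ?_)
  push_cast
  ring

/-- Chebyshev's inequality for a noncentral chi-square variable. -/
lemma one_sub_le_measureReal_abs_sum_sq_sub_lt {n : ℕ} (c : Fin n → ℝ) {δ : ℝ} (hδ : 0 < δ) :
    1 - (8 * ∑ i, c i ^ 2 + 2 * Var[fun x => x ^ 2; gaussianReal 0 1] * n) / δ ^ 2
      ≤ (Measure.pi fun _ : Fin n => gaussianReal 0 1).real
        {x | |∑ i, (c i + x i) ^ 2 - (n + ∑ i, c i ^ 2)| < δ} := by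
  set P := Measure.pi fun _ : Fin n => gaussianReal 0 1
  set K := Var[fun x => x ^ 2; gaussianReal 0 1]
  have hm : ∀ i, MemLp (fun x : Fin n → ℝ => (c i + x i) ^ 2) 2 P := fun i =>
    (memLp_const_add_sq_gaussianReal 0 1 (c i)).comp_measurePreserving
      (measurePreserving_eval (fun _ : Fin n => gaussianReal 0 1) i)
  have hS : MemLp (fun x : Fin n → ℝ => ∑ i, (c i + x i) ^ 2) 2 P :=
    memLp_finsetSum _ fun i _ => hm i
  have hE : ∫ x, ∑ i, (c i + x i) ^ 2 ∂P = n + ∑ i, c i ^ 2 := by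
    rw [integral_finsetSum _ fun i _ => (hm i).integrable (by norm_num)]
    have (i : Fin n) : ∫ x, (c i + x i) ^ 2 ∂P = c i ^ 2 + 1 :=
      (integral_comp_eval (μ := fun _ : Fin n => gaussianReal 0 1) (i := i)
        (f := fun t : ℝ => (c i + t) ^ 2) (by fun_prop)).trans
        (integral_const_add_sq_gaussianReal _)
    simp_rw [this, Finset.sum_add_distrib]
    simp [add_comm]
  have hV : Var[fun x : Fin n → ℝ => ∑ i, (c i + x i) ^ 2; P]
      ≤ 8 * ∑ i, c i ^ 2 + 2 * K * n := by
    have h := variance_sum_pi (μ := fun _ : Fin n => gaussianReal 0 1)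
      (X := fun i x => (c i + x) ^ 2) fun i => memLp_const_add_sq_gaussianReal 0 1 (c i)
    have e : (∑ i, fun x : Fin n → ℝ => (c i + x i) ^ 2)
        = fun x => ∑ i, (c i + x i) ^ 2 := by
      ext x; simp
    rw [e] at h
    rw [h]
    refine (Finset.sum_le_sum fun i _ => variance_const_add_sq_gaussianReal_le (c i)).trans
      (le_of_eq ?_)
    rw [Finset.sum_add_distrib, ← Finset.mul_sum]
    simp [K]
    ring
  have hC := meas_ge_le_variance_div_sq hS hδ
  rw [hE] at hC
  have hmeas : MeasurableSet
      {x : Fin n → ℝ | δ ≤ |∑ i, (c i + x i) ^ 2 - (n + ∑ i, c i ^ 2)|} :=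
    measurableSet_le (by fun_prop) (by fun_prop)
  have hcompl : {x : Fin n → ℝ | |∑ i, (c i + x i) ^ 2 - (n + ∑ i, c i ^ 2)| < δ}
      = {x | δ ≤ |∑ i, (c i + x i) ^ 2 - (n + ∑ i, c i ^ 2)|}ᶜ := by
    ext x; simp
  rw [hcompl, probReal_compl_eq_one_sub hmeas]
  refine sub_le_sub_left ?_ 1
  refine (ENNReal.toReal_le_of_le_ofReal ?_ hC).trans ?_
  · exact div_nonneg (variance_nonneg _ _) (sq_nonneg _)
  · gcongr

lemma sum_ite_val_eq_zero_sq {n : ℕ} (hn : 0 < n) (a : ℝ) :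
    ∑ i : Fin n, (if i.val = 0 then a else 0) ^ 2 = a ^ 2 := by
  rw [Finset.sum_eq_single (⟨0, hn⟩ : Fin n)]
  · simp
  · intro i _ hi
    have : i.val ≠ 0 := fun h => hi (Fin.ext h)
    simp [this]
  · simp

lemma missProb_le_one (NR Ns L : ℕ) (η γ : ℝ) : missProb NR Ns L η γ ≤ 1 :=
  measureReal_le_one

/-- Above the threshold the miss-detection probability tends to one. -/
lemma tendsto_missProb_one {NR Ns : ℕ} (hNR : 1 ≤ NR) (hNs : 2 ≤ Ns) {η γ : ℝ}
    (hη : 0 < η) (hγ : 0 < γ)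
    (hth : (2 * (NR : ℝ) + η) / (2 * (NR : ℝ) * ((Ns : ℝ) - 1)) < γ) :
    Filter.Tendsto (fun L : ℕ => missProb NR Ns L η γ) Filter.atTop (nhds 1) := by
  have hNR' : (1 : ℝ) ≤ NR := by exact_mod_cast hNR
  have hNs' : (2 : ℝ) ≤ Ns := by exact_mod_cast hNs
  rw [div_lt_iff₀ (by nlinarith)] at hth
  obtain ⟨δ, hδ⟩ : ∃ δ, δ = γ * (2 * (NR : ℝ) * ((Ns : ℝ) - 1)) - (2 * (NR : ℝ) + η) :=
    ⟨_, rfl⟩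
  have hδ0 : 0 < δ := by linarith
  set K := Var[fun x => x ^ 2; gaussianReal 0 1] with hK
  set a := (8 * η + 2 * K * (2 * NR)) / (δ / 2) ^ 2 with ha
  set b := 2 * K * (2 * NR * (Ns - 1)) / (δ / (2 * γ)) ^ 2 with hb
  have hab : Filter.Tendsto (fun L : ℕ => (1 - a / (L : ℝ)) * (1 - b / (L : ℝ)))
      Filter.atTop (nhds 1) := by
    simpa using (tendsto_const_nhds.sub (tendsto_const_div_atTop_nhds_zero_nat a)).mul
      ((tendsto_const_nhds (x := (1 : ℝ))).sub (tendsto_const_div_atTop_nhds_zero_nat b))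
  refine tendsto_of_tendsto_of_tendsto_of_le_of_le' hab tendsto_const_nhds ?_
    (Filter.Eventually.of_forall fun L => missProb_le_one NR Ns L η γ)
  filter_upwards [Filter.eventually_ge_atTop 1,
    tendsto_natCast_atTop_atTop.eventually_ge_atTop b] with L hL hbL
  have hL0 : (0 : ℝ) < L := by exact_mod_cast hL
  have hn : 0 < 2 * NR * L := by positivity
  have hA := one_sub_le_measureReal_abs_sum_sq_sub_lt
    (fun i : Fin (2 * NR * L) => if i.val = 0 then Real.sqrt (L * η) else 0)
    (show 0 < L * (δ / 2) by positivity)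
  have hB := one_sub_le_measureReal_abs_sum_sq_sub_lt
    (fun _ : Fin (2 * NR * (Ns - 1) * L) => (0 : ℝ))
    (show 0 < L * (δ / (2 * γ)) by positivity)
  simp only [sum_ite_val_eq_zero_sq hn, Real.sq_sqrt (show 0 ≤ L * η by positivity)] at hA
  simp only [zero_add, ne_eq, OfNat.ofNat_ne_zero, not_false_eq_true, zero_pow,
    Finset.sum_const_zero, mul_zero, add_zero] at hB
  have hsub : ((Ns - 1 : ℕ) : ℝ) = (Ns : ℝ) - 1 := by
    rw [Nat.cast_sub (by omega)]; simp
  push_cast [hsub] at hA hB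
  have hAa : (8 * (L * η) + 2 * K * (2 * NR * L)) / (L * (δ / 2)) ^ 2 = a / L := by
    rw [ha]; field_simp
  have hBb : 2 * K * (2 * NR * (Ns - 1) * L) / (L * (δ / (2 * γ))) ^ 2 = b / L := by
    rw [hb]; field_simp
  rw [← hK, hAa] at hA
  rw [← hK, hBb] at hB
  refine (mul_le_mul hA hB ?_ measureReal_nonneg).trans ?_
  · rw [sub_nonneg, div_le_one hL0]
    exact hbL
  rw [← measureReal_prod_prod]
  refine measureReal_mono ?_
  rintro ⟨x, y⟩ ⟨hx, hy⟩
  simp only [Set.mem_ofPred_eq, abs_lt] at hx hy ⊢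
  have h1 := mul_lt_mul_of_pos_left hy.1 hγ
  have h2 : γ * -(L * (δ / (2 * γ))) = -(L * (δ / 2)) := by field_simp
  have h3 : L * δ = γ * (2 * NR * (Ns - 1) * L) - (2 * NR * L + L * η) := by
    rw [hδ]; ring
  rw [h2, mul_sub] at h1
  linarith [hx.2]

/-- Second case of Eq. (LDP:L) of Proposition 3, above the threshold: if
`γ > (2N_R + η)/(2N_R(N_s−1))`, then `lim_{L→∞} −(1/L) log p_L = 0`. -/
theorem stmt_16 (NR Ns : ℕ) (hNR : 1 ≤ NR) (hNs : 2 ≤ Ns) (η γ : ℝ)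
    (hη : 0 < η) (hγ : 0 < γ)
    (hth : (2 * (NR : ℝ) + η) / (2 * (NR : ℝ) * ((Ns : ℝ) - 1)) < γ) :
    Filter.Tendsto (fun L : ℕ => -(1 / (L : ℝ)) * Real.log (missProb NR Ns L η γ))
      Filter.atTop (nhds 0) := by
  simpa using (tendsto_const_div_atTop_nhds_zero_nat (1 : ℝ)).neg.mul
    ((tendsto_missProb_one hNR hNs hη hγ hth).log one_ne_zero)
end

section
/- Let (Ω, 𝓐, ν) be a measure space with 0 < ν(Ω) < ∞, and let α : Ω → ℝ be measurable, strictly positive, and ν-integrable, with mean ᾱ = (1/ν(Ω)) ∫_Ω α dν > 0. Define G*(φ) = (4π/ν(Ω)) · α(φ)/ᾱ. Then (1/(4π)) ∫_Ω G* dν = 1, the essential infimum of G*/α over Ω equals 4π/(ν(Ω)·ᾱ), and for every measurable G : Ω → ℝ with G ≥ 0 and (1/(4π)) ∫_Ω G dν ≤ 1, the essential infimum of G(φ)/α(φ) over Ω (with respect to ν) is at most 4π/(ν(Ω)·ᾱ). Hence G* solves max_G min_{φ∈Ω} G(φ)/α(φ) subject to (1/(4π)) ∫_Ω G dν ≤ 1.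 -/
open MeasureTheory

/-- If `∫ G ≤ M * ∫ α` with `G` nonnegative and `α` positive, then the essential infimum of
`G / α` is at most `M`. -/
theorem essInf_div_le_of_integral_le {Ω : Type*} [MeasurableSpace Ω] {ν : Measure Ω}
    {α G : Ω → ℝ} {M : ℝ} (hαpos : ∀ φ, 0 < α φ) (hαint : Integrable α ν)
    (hαI : 0 < ∫ φ, α φ ∂ν) (hG : ∀ φ, 0 ≤ G φ) (hGint : Integrable G ν)
    (hle : ∫ φ, G φ ∂ν ≤ M * ∫ φ, α φ ∂ν) :
    essInf (fun φ => G φ / α φ) ν ≤ M := by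
  rw [essInf, Filter.liminf_eq]
  refine csSup_le ⟨0, ae_of_all ν fun φ => div_nonneg (hG φ) (hαpos φ).le⟩ fun a ha => ?_
  have h : ∫ φ, a * α φ ∂ν ≤ ∫ φ, G φ ∂ν := by
    refine integral_mono_ae (hαint.const_mul a) hGint ?_
    filter_upwards [ha] with φ hφ
    exact (le_div_iff₀ (hαpos φ)).mp hφ
  rw [integral_const_mul] at h
  exact le_of_mul_le_mul_right (h.trans hle) hαI

/-- The desirable beam pattern `G*(φ) = (4π/ν(Ω)) α(φ)/ᾱ` of Eq. (14) satisfies the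
energy constraint with equality, achieves `G*/α ≡ 4π/(ν(Ω) ᾱ)`, and solves the
max–min problem `max_G min_φ G(φ)/α(φ)` subject to `(1/4π)∫ G dν ≤ 1`. -/
theorem stmt_19 {Ω : Type*} [MeasurableSpace Ω] (ν : Measure Ω)
    (hν0 : 0 < ν Set.univ) (hνfin : ν Set.univ < ⊤)
    (α : Ω → ℝ) (hαmeas : Measurable α) (hαpos : ∀ φ, 0 < α φ)
    (hαint : Integrable α ν)
    (abar : ℝ) (habar : abar = (1 / (ν Set.univ).toReal) * ∫ φ, α φ ∂ν)
    (habarpos : 0 < abar)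
    (Gstar : Ω → ℝ)
    (hGstar : Gstar = fun φ => (4 * Real.pi / (ν Set.univ).toReal) * (α φ / abar)) :
    (1 / (4 * Real.pi)) * ∫ φ, Gstar φ ∂ν = 1 ∧
    essInf (fun φ => Gstar φ / α φ) ν = 4 * Real.pi / ((ν Set.univ).toReal * abar) ∧
    ∀ G : Ω → ℝ, Measurable G → (∀ φ, 0 ≤ G φ) → Integrable G ν →
      (1 / (4 * Real.pi)) * ∫ φ, G φ ∂ν ≤ 1 →
      essInf (fun φ => G φ / α φ) ν ≤ 4 * Real.pi / ((ν Set.univ).toReal * abar) := by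
  have hπ := Real.pi_pos
  have hm : 0 < (ν Set.univ).toReal := ENNReal.toReal_pos hν0.ne' hνfin.ne
  have hI : ∫ φ, α φ ∂ν = (ν Set.univ).toReal * abar := by
    rw [habar]
    field_simp
  refine ⟨?_, ?_, fun G _ hG hGint hGle => ?_⟩
  · rw [hGstar, integral_const_mul, integral_div, hI]
    field_simp
  · have hconst : (fun φ => Gstar φ / α φ) =
        fun _ => 4 * Real.pi / ((ν Set.univ).toReal * abar) := by
      funext φ
      have := hαpos φ
      rw [hGstar]
      field_simp
    have : (ae ν).NeBot := ae_neBot.mpr (Measure.measure_univ_pos.mp hν0)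
    rw [hconst, essInf, Filter.liminf_const]
  · have hpos : 0 < (ν Set.univ).toReal * abar := mul_pos hm habarpos
    refine essInf_div_le_of_integral_le hαpos hαint (hI ▸ hpos) hG hGint ?_
    rw [hI, div_mul_cancel₀ _ hpos.ne']
    rwa [one_div_mul_eq_div, div_le_one (by positivity)] at hGle
end
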